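/- arXiv:2302.13044 — 2 statements merged into one kernel-verified Lean document; each statement's English description precedes it below -/
import Mathlib

section
/- Let P be an admissible two-point kernel for β and J, let S ⊂ ℤ^d be a finite set containing 0, and let t ∈ ℝ^d, δ > 0 be such that ∑_{x∈ℤ^d} e^{⟨h,x⟩} J(x) < ∞ for every h with ‖h − t‖ < δ. If φ_β(S,t) < 1, then there exists ε > 0 such that φ_β(S,h) < 1 for every h with ‖h − t‖ < ε; consequently, for every such h there is a constant C(h) < ∞ with ∑_{v∈Λ} e^{⟨h, v−u⟩} P_Λ(u,v) ≤ C(h) for every finite Λ ⊂ ℤ^d and every u ∈ Λ. -/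
open scoped BigOperators ENNReal

noncomputable section

/-- The lattice `ℤ^d`. -/
abbrev Zd (d : ℕ) := Fin d → ℤ

/-- Standard inner product `⟨t, x⟩` between `t ∈ ℝ^d` and a lattice point `x ∈ ℤ^d`. -/
def dotp {d : ℕ} (t : Fin d → ℝ) (x : Zd d) : ℝ := ∑ i, t i * (x i : ℝ)

/-- The box `Λ_n = {−n,…,n}^d ⊂ ℤ^d`. -/
def box (d n : ℕ) : Finset (Zd d) := Fintype.piFinset fun _ => Finset.Icc (-(n : ℤ)) (n : ℤ)

/-- An admissible two-point kernel for `β` and `J`: a family `P_Λ : ℤ^d × ℤ^d → [0,1]`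
indexed by finite `Λ ⊂ ℤ^d`, vanishing unless both arguments lie in `Λ`,
translation invariant, and satisfying the Simon–Lieb inequality.
(Since `P_Λ(y,v) = 0` for `y ∉ Λ`, the sum over `y ∉ u+S` in the Simon–Lieb
inequality is written as a finite sum over `y ∈ Λ \ (u+S)`.) -/
structure AdmissibleKernel (d : ℕ) (β : ℝ) (J : Zd d → ℝ) where
  P : Finset (Zd d) → Zd d → Zd d → ℝ
  nonneg : ∀ Λ u v, 0 ≤ P Λ u v
  le_one : ∀ Λ u v, P Λ u v ≤ 1
  vanish_left : ∀ Λ u v, u ∉ Λ → P Λ u v = 0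
  vanish_right : ∀ Λ u v, v ∉ Λ → P Λ u v = 0
  translation : ∀ (w : Zd d) (Λ : Finset (Zd d)) (u v : Zd d),
      P (Λ.image (w + ·)) (w + u) (w + v) = P Λ u v
  simon_lieb : ∀ (S : Finset (Zd d)), (0 : Zd d) ∈ S →
      ∀ (Λ : Finset (Zd d)), ∀ u ∈ Λ, ∀ v ∈ Λ, v ∉ S.image (u + ·) →
        P Λ u v ≤ β * ∑ x ∈ S.image (u + ·), ∑ y ∈ Λ \ S.image (u + ·),
          P (S.image (u + ·)) u x * J (y - x) * P Λ y v

/-- A kernel is volume monotone if `P_Λ(u,v) ≤ P_{Λ'}(u,v)` whenever `Λ ⊆ Λ'`. -/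
def VolumeMonotone {d : ℕ} {β : ℝ} {J : Zd d → ℝ} (K : AdmissibleKernel d β J) : Prop :=
  ∀ (Λ Λ' : Finset (Zd d)), Λ ⊆ Λ' → ∀ u v, K.P Λ u v ≤ K.P Λ' u v

/-- `φ_β(S,t) = β ∑_{x∈S} ∑_{y∉S} e^{⟨t,x⟩} P_S(0,x) J(y−x) e^{⟨t,y−x⟩}`,
valued in `[0,∞]` (the sum over `y ∉ S` is an infinite sum of nonnegative terms). -/
def phiE {d : ℕ} {β : ℝ} {J : Zd d → ℝ} (K : AdmissibleKernel d β J)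
    (S : Finset (Zd d)) (t : Fin d → ℝ) : ℝ≥0∞ :=
  ENNReal.ofReal β * ∑ x ∈ S, ∑' y : {y : Zd d // y ∉ S},
    ENNReal.ofReal (Real.exp (dotp t x) * K.P S 0 x * J ((y : Zd d) - x)
      * Real.exp (dotp t ((y : Zd d) - x)))

/-- Euclidean distance on `ℝ^d`. -/
def eDist {d : ℕ} (h t : Fin d → ℝ) : ℝ := Real.sqrt (∑ i, (h i - t i) ^ 2)

lemma dotp_add {d : ℕ} (t : Fin d → ℝ) (x y : Zd d) : dotp t (x + y) = dotp t x + dotp t y := by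
  simp [dotp, mul_add, Finset.sum_add_distrib]

lemma continuous_dotp {d : ℕ} (x : Zd d) : Continuous fun h : Fin d → ℝ => dotp h x := by
  unfold dotp
  fun_prop

lemma dist_le_eDist {d : ℕ} (h t : Fin d → ℝ) : dist h t ≤ eDist h t := by
  refine (dist_pi_le_iff (Real.sqrt_nonneg _)).2 fun i => ?_
  rw [Real.dist_eq]
  refine Real.abs_le_sqrt ?_
  exact Finset.single_le_sum (f := fun i => (h i - t i) ^ 2) (fun _ _ => sq_nonneg _)
    (Finset.mem_univ i)

/-- On a sup-norm ball around `t`, the exponential tilt is dominated by the sum of the tilts at the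
vertices of the corresponding cube. -/
lemma exp_dotp_le_sum_vertices {d : ℕ} {h t : Fin d → ℝ} {η : ℝ} (hη : dist h t ≤ η) (x : Zd d) :
    Real.exp (dotp h x) ≤
      ∑ σ : Fin d → Bool, Real.exp (dotp (fun i => t i + if σ i then η else -η) x) := by
  refine le_trans ?_ (Finset.single_le_sum
    (f := fun σ : Fin d → Bool => Real.exp (dotp (fun i => t i + if σ i then η else -η) x))
    (fun _ _ => (Real.exp_pos _).le) (Finset.mem_univ fun i => decide (0 ≤ x i)))
  refine Real.exp_le_exp.2 (Finset.sum_le_sum fun i _ => ?_)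
  have hi : |h i - t i| ≤ η := (Real.dist_eq _ _ ▸ dist_le_pi_dist h t i).trans hη
  obtain ⟨h₁, h₂⟩ := abs_le.1 hi
  by_cases hx : 0 ≤ x i
  · have : (0 : ℝ) ≤ x i := by exact_mod_cast hx
    simp only [hx, decide_true, if_true]
    exact mul_le_mul_of_nonneg_right (by linarith) this
  · have : (x i : ℝ) ≤ 0 := by exact_mod_cast (not_le.1 hx).le
    simp only [hx, decide_false, Bool.false_eq_true, if_false]
    exact mul_le_mul_of_nonpos_right (by linarith) this

lemma exists_summable_dominating {d : ℕ} {J : Zd d → ℝ} (hJ : ∀ x, 0 ≤ J x) {t : Fin d → ℝ}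
    {δ : ℝ} (hδ : 0 < δ)
    (hfin : ∀ h : Fin d → ℝ, eDist h t < δ → Summable fun x : Zd d => Real.exp (dotp h x) * J x) :
    ∃ η > 0, ∃ g : Zd d → ℝ, Summable g ∧
      ∀ h : Fin d → ℝ, dist h t ≤ η → ∀ x, Real.exp (dotp h x) * J x ≤ g x := by
  refine ⟨δ / (d + 1), by positivity, fun x => ∑ σ : Fin d → Bool,
    Real.exp (dotp (fun i => t i + if σ i then δ / (d + 1) else -(δ / (d + 1))) x) * J x,
    summable_sum fun σ _ => hfin _ ?_, fun h hh x => ?_⟩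
  · have hsq : ∀ i, (t i + (if σ i then δ / (d + 1) else -(δ / (d + 1))) - t i) ^ 2
        = (δ / (d + 1)) ^ 2 := fun i => by split_ifs <;> ring
    rw [eDist, Real.sqrt_lt' hδ, Finset.sum_congr rfl fun i _ => hsq i]
    simp only [Finset.sum_const, Finset.card_univ, Fintype.card_fin, nsmul_eq_mul, div_pow]
    rw [mul_div_assoc', div_lt_iff₀ (by positivity), mul_comm]
    gcongr
    have : (0 : ℝ) ≤ d := d.cast_nonneg
    nlinarith
  · beta_reduce
    rw [← Finset.sum_mul]
    exact mul_le_mul_of_nonneg_right (exp_dotp_le_sum_vertices hh x) (hJ x)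

section

variable {d : ℕ} {β : ℝ} {J : Zd d → ℝ}

/-- The real-valued version of `phiE`. -/
def phiReal (K : AdmissibleKernel d β J) (S : Finset (Zd d)) (h : Fin d → ℝ) : ℝ :=
  β * ∑ x ∈ S, Real.exp (dotp h x) * K.P S 0 x *
    ∑' y : {y : Zd d // y ∉ S}, Real.exp (dotp h ((y : Zd d) - x)) * J ((y : Zd d) - x)

lemma injective_coe_sub (S : Finset (Zd d)) (x : Zd d) :
    Function.Injective fun y : {y : Zd d // y ∉ S} => (y : Zd d) - x :=
  (sub_left_injective (b := x)).comp Subtype.val_injective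

lemma phiE_eq_ofReal_phiReal (hβ : 0 ≤ β) (hJ : ∀ x, 0 ≤ J x) (K : AdmissibleKernel d β J)
    (S : Finset (Zd d)) {h : Fin d → ℝ} (hs : Summable fun x : Zd d => Real.exp (dotp h x) * J x) :
    phiE K S h = ENNReal.ofReal (phiReal K S h) := by
  have hP : ∀ x, 0 ≤ Real.exp (dotp h x) * K.P S 0 x :=
    fun x => mul_nonneg (Real.exp_pos _).le (K.nonneg _ _ _)
  have hE : ∀ x, 0 ≤ Real.exp (dotp h x) * J x := fun x => mul_nonneg (Real.exp_pos _).le (hJ x)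
  rw [phiE, phiReal, ENNReal.ofReal_mul hβ, ENNReal.ofReal_sum_of_nonneg
    fun x _ => mul_nonneg (hP x) (tsum_nonneg fun y => hE _)]
  congr 1
  refine Finset.sum_congr rfl fun x _ => ?_
  rw [← tsum_mul_left, ENNReal.ofReal_tsum_of_nonneg (fun y => mul_nonneg (hP x) (hE _))
    ((hs.comp_injective (injective_coe_sub S x)).mul_left _)]
  refine tsum_congr fun y => ?_
  congr 1
  ring

lemma continuousAt_phiReal (hJ : ∀ x, 0 ≤ J x) (K : AdmissibleKernel d β J) (S : Finset (Zd d))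
    {t : Fin d → ℝ} {η : ℝ} (hη : 0 < η) {g : Zd d → ℝ} (hg : Summable g)
    (hle : ∀ h : Fin d → ℝ, dist h t ≤ η → ∀ x, Real.exp (dotp h x) * J x ≤ g x) :
    ContinuousAt (phiReal K S) t := by
  have hexp : ∀ x : Zd d, ContinuousAt (fun h : Fin d → ℝ => Real.exp (dotp h x)) t :=
    fun x => (Real.continuous_exp.comp (continuous_dotp x)).continuousAt
  refine continuousAt_const.mul (tendsto_finsetSum _ fun x _ => ?_)
  refine ((hexp x).mul continuousAt_const).mul ?_
  refine tendsto_tsum_of_dominated_convergence (hg.comp_injective (injective_coe_sub S x))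
    (fun y => (hexp _).mul continuousAt_const) ?_
  filter_upwards [Metric.closedBall_mem_nhds t hη] with h hh y
  rw [Real.norm_of_nonneg (mul_nonneg (Real.exp_pos _).le (hJ _))]
  exact hle h hh _

lemma exists_forall_phiE_lt_one (hβ : 0 ≤ β) (hJ : ∀ x, 0 ≤ J x) (K : AdmissibleKernel d β J)
    (S : Finset (Zd d)) {t : Fin d → ℝ} {δ : ℝ} (hδ : 0 < δ)
    (hfin : ∀ h : Fin d → ℝ, eDist h t < δ → Summable fun x : Zd d => Real.exp (dotp h x) * J x)
    (hφ : phiE K S t < 1) :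
    ∃ ε : ℝ, 0 < ε ∧ ∀ h : Fin d → ℝ, eDist h t < ε → phiE K S h < 1 := by
  obtain ⟨η, hη, g, hg, hle⟩ := exists_summable_dominating hJ hδ hfin
  have ht : phiReal K S t < 1 := by
    rwa [phiE_eq_ofReal_phiReal hβ hJ K S (hfin t (by simpa [eDist] using hδ)),
      ENNReal.ofReal_lt_one] at hφ
  obtain ⟨ε, hε, hball⟩ := Metric.eventually_nhds_iff.1
    ((continuousAt_phiReal hJ K S hη hg hle).eventually (gt_mem_nhds ht))
  refine ⟨min ε δ, lt_min hε hδ, fun h hh => ?_⟩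
  rw [phiE_eq_ofReal_phiReal hβ hJ K S (hfin h (hh.trans_le (min_le_right _ _))),
    ENNReal.ofReal_lt_one]
  exact hball ((dist_le_eDist h t).trans_lt (hh.trans_le (min_le_left _ _)))

lemma sum_sum_le_toReal_phiE (hβ : 0 ≤ β) (hJ : ∀ x, 0 ≤ J x) (K : AdmissibleKernel d β J)
    {S T : Finset (Zd d)} (hST : Disjoint S T) {h : Fin d → ℝ} (hφ : phiE K S h ≠ ⊤) :
    β * ∑ x ∈ S, ∑ y ∈ T, Real.exp (dotp h y) * K.P S 0 x * J (y - x) ≤ (phiE K S h).toReal := by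
  have h0 : ∀ x y, 0 ≤ Real.exp (dotp h y) * K.P S 0 x * J (y - x) :=
    fun x y => mul_nonneg (mul_nonneg (Real.exp_pos _).le (K.nonneg _ _ _)) (hJ _)
  rw [← ENNReal.ofReal_le_iff_le_toReal hφ, ENNReal.ofReal_mul hβ,
    ENNReal.ofReal_sum_of_nonneg fun x _ => Finset.sum_nonneg fun y _ => h0 x y, phiE]
  gcongr with x hx
  rw [ENNReal.ofReal_sum_of_nonneg fun y _ => h0 x y,
    ← Finset.sum_subtype_of_mem (p := fun y => y ∉ S) _
      fun y hy hyS => Finset.disjoint_left.1 hST hyS hy]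
  refine le_trans (Finset.sum_le_sum fun y _ => ?_) (ENNReal.sum_le_tsum _)
  apply le_of_eq
  congr 1
  have hy : dotp h (y : Zd d) = dotp h x + dotp h ((y : Zd d) - x) := by
    rw [← dotp_add, add_sub_cancel]
  rw [hy, Real.exp_add]
  ring

/-- The tilted finite-volume susceptibility. -/
def susceptibility (K : AdmissibleKernel d β J) (h : Fin d → ℝ) (Λ : Finset (Zd d)) (u : Zd d) :
    ℝ :=
  ∑ v ∈ Λ, Real.exp (dotp h (v - u)) * K.P Λ u v

lemma sum_sum_translate_le_toReal_phiE (hβ : 0 ≤ β) (hJ : ∀ x, 0 ≤ J x)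
    (K : AdmissibleKernel d β J) {S : Finset (Zd d)} {h : Fin d → ℝ} (hφ : phiE K S h ≠ ⊤)
    (Λ : Finset (Zd d)) (u : Zd d) :
    β * ∑ x ∈ S.image (u + ·), ∑ y ∈ Λ \ S.image (u + ·),
      Real.exp (dotp h (y - u)) * K.P (S.image (u + ·)) u x * J (y - x)
      ≤ (phiE K S h).toReal := by
  have hdisj : Disjoint S ((Λ \ S.image (u + ·)).image (· - u)) := by
    refine Finset.disjoint_left.2 fun x hx hx' => ?_
    obtain ⟨y, hy, rfl⟩ := Finset.mem_image.1 hx'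
    exact (Finset.mem_sdiff.1 hy).2 (Finset.mem_image.2 ⟨_, hx, add_sub_cancel u y⟩)
  refine le_trans (le_of_eq ?_) (sum_sum_le_toReal_phiE hβ hJ K hdisj hφ)
  rw [Finset.sum_image fun a _ b _ hab => add_left_cancel hab]
  congr 1
  refine Finset.sum_congr rfl fun x _ => ?_
  rw [Finset.sum_image fun a _ b _ hab => sub_left_injective hab]
  refine Finset.sum_congr rfl fun y _ => ?_
  have hP := K.translation u S 0 x
  rw [add_zero] at hP
  rw [hP, sub_sub]

lemma susceptibility_le_add (hβ : 0 ≤ β) (hJ : ∀ x, 0 ≤ J x) (K : AdmissibleKernel d β J)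
    {S : Finset (Zd d)} (hS : 0 ∈ S) {h : Fin d → ℝ} (hφ : phiE K S h ≠ ⊤) {Λ : Finset (Zd d)}
    {M : ℝ} (hM₀ : 0 ≤ M) (hM : ∀ y ∈ Λ, susceptibility K h Λ y ≤ M) {u : Zd d} (hu : u ∈ Λ) :
    susceptibility K h Λ u ≤ ∑ x ∈ S, Real.exp (dotp h x) + (phiE K S h).toReal * M := by
  rw [susceptibility, ← Finset.sum_inter_add_sum_sdiff Λ (S.image (u + ·))]
  refine add_le_add ?_ ?_
  · calc ∑ v ∈ Λ ∩ S.image (u + ·), Real.exp (dotp h (v - u)) * K.P Λ u v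
        ≤ ∑ v ∈ S.image (u + ·), Real.exp (dotp h (v - u)) := by
          refine (Finset.sum_le_sum fun v _ => mul_le_of_le_one_right (Real.exp_pos _).le
            (K.le_one _ _ _)).trans ?_
          exact Finset.sum_le_sum_of_subset_of_nonneg Finset.inter_subset_right
            fun _ _ _ => (Real.exp_pos _).le
      _ = ∑ x ∈ S, Real.exp (dotp h x) := by
          rw [Finset.sum_image fun a _ b _ hab => add_left_cancel hab]
          simp
  · set U := S.image (u + ·) with hU
    have hw : ∀ x y, 0 ≤ Real.exp (dotp h (y - u)) * K.P U u x * J (y - x) :=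
      fun x y => mul_nonneg (mul_nonneg (Real.exp_pos _).le (K.nonneg _ _ _)) (hJ _)
    calc ∑ v ∈ Λ \ U, Real.exp (dotp h (v - u)) * K.P Λ u v
        ≤ ∑ v ∈ Λ \ U, Real.exp (dotp h (v - u)) *
            (β * ∑ x ∈ U, ∑ y ∈ Λ \ U, K.P U u x * J (y - x) * K.P Λ y v) := by
          refine Finset.sum_le_sum fun v hv => ?_
          obtain ⟨hvΛ, hvU⟩ := Finset.mem_sdiff.1 hv
          exact mul_le_mul_of_nonneg_left (K.simon_lieb S hS Λ u hu v hvΛ hvU) (Real.exp_pos _).le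
      _ = β * ∑ x ∈ U, ∑ y ∈ Λ \ U, Real.exp (dotp h (y - u)) * K.P U u x * J (y - x) *
            ∑ v ∈ Λ \ U, Real.exp (dotp h (v - y)) * K.P Λ y v := by
          simp only [Finset.mul_sum]
          rw [Finset.sum_comm]
          refine Finset.sum_congr rfl fun x _ => ?_
          rw [Finset.sum_comm]
          refine Finset.sum_congr rfl fun y _ => Finset.sum_congr rfl fun v _ => ?_
          have hv : dotp h (v - u) = dotp h (y - u) + dotp h (v - y) := by
            rw [← dotp_add, add_comm, sub_add_sub_cancel]
          rw [hv, Real.exp_add]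
          ring
      _ ≤ β * ∑ x ∈ U, ∑ y ∈ Λ \ U,
            Real.exp (dotp h (y - u)) * K.P U u x * J (y - x) * M := by
          refine mul_le_mul_of_nonneg_left (Finset.sum_le_sum fun x _ =>
            Finset.sum_le_sum fun y hy => mul_le_mul_of_nonneg_left ?_ (hw x y)) hβ
          refine le_trans ?_ (hM y (Finset.mem_sdiff.1 hy).1)
          exact Finset.sum_le_sum_of_subset_of_nonneg Finset.sdiff_subset
            fun _ _ _ => mul_nonneg (Real.exp_pos _).le (K.nonneg _ _ _)
      _ ≤ (phiE K S h).toReal * M := by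
          simp only [← Finset.sum_mul, ← mul_assoc]
          exact mul_le_mul_of_nonneg_right (sum_sum_translate_le_toReal_phiE hβ hJ K hφ Λ u) hM₀

lemma susceptibility_le (hβ : 0 ≤ β) (hJ : ∀ x, 0 ≤ J x) (K : AdmissibleKernel d β J)
    {S : Finset (Zd d)} (hS : 0 ∈ S) {h : Fin d → ℝ} (hφ : phiE K S h < 1) {Λ : Finset (Zd d)}
    {u : Zd d} (hu : u ∈ Λ) :
    susceptibility K h Λ u ≤ (∑ x ∈ S, Real.exp (dotp h x)) / (1 - (phiE K S h).toReal) := by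
  have hr : (phiE K S h).toReal < 1 := by
    simpa using (ENNReal.toReal_lt_toReal hφ.ne_top ENNReal.one_ne_top).2 hφ
  obtain ⟨w, hw, hmax⟩ := Λ.exists_max_image (susceptibility K h Λ) ⟨u, hu⟩
  have hw₀ : 0 ≤ susceptibility K h Λ w :=
    Finset.sum_nonneg fun _ _ => mul_nonneg (Real.exp_pos _).le (K.nonneg _ _ _)
  have := susceptibility_le_add hβ hJ K hS hφ.ne_top hw₀ hmax hw
  refine (hmax u hu).trans ((le_div_iff₀ (by linarith)).2 ?_)
  linarith

end

/-- if the tilted Laplace transform of `J` is finite on the Euclidean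
`δ`-ball around `t` and `φ_β(S,t) < 1`, then `φ_β(S,h) < 1` for all `h` in some
`ε`-ball around `t`, and consequently for every such `h` the tilted finite-volume
susceptibilities `∑_{v∈Λ} e^{⟨h,v−u⟩} P_Λ(u,v)` are bounded by a constant `C(h)`
uniformly in the finite volume `Λ` and in `u ∈ Λ`. -/
theorem statement7 {d : ℕ} (β : ℝ) (hβ : 0 < β) (J : Zd d → ℝ)
    (hJ0 : J 0 = 0) (hJnn : ∀ x, 0 ≤ J x)
    (K : AdmissibleKernel d β J)
    (S : Finset (Zd d)) (hS : (0 : Zd d) ∈ S)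
    (t : Fin d → ℝ) (δ : ℝ) (hδ : 0 < δ)
    (hfin : ∀ h : Fin d → ℝ, eDist h t < δ →
      Summable (fun x : Zd d => Real.exp (dotp h x) * J x))
    (hφ : phiE K S t < 1) :
    ∃ ε : ℝ, 0 < ε ∧ ∀ h : Fin d → ℝ, eDist h t < ε →
      phiE K S h < 1 ∧
      ∃ C : ℝ, ∀ (Λ : Finset (Zd d)), ∀ u ∈ Λ,
        ∑ v ∈ Λ, Real.exp (dotp h (v - u)) * K.P Λ u v ≤ C := by
  obtain ⟨ε, hε, hlt⟩ := exists_forall_phiE_lt_one hβ.le hJnn K S hδ hfin hφ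
  exact ⟨ε, hε, fun h hh => ⟨hlt h hh, _, fun Λ u hu =>
    susceptibility_le hβ.le hJnn K hS (hlt h hh) hu⟩⟩
end
end

section
/- Let G = (V,E) be a finite graph with coupling constants J : E → ℝ≥0 and β > 0, and let w, ∂ and Z be the associated random-current weight, source map and partition functions. Then for every F ⊆ V and every edge f ∈ E, one has ∑_{n : ∂n = F and n_f = 0} w(n) ≤ 2 e^{−βJ_f} · Z(F). -/
open scoped BigOperators

noncomputable section

variable {V E : Type} [Fintype V] [Fintype E] [DecidableEq V] [DecidableEq E]

/-- The degree `∑_{e ∋ x} n_e` of a vertex `x` in a current `n` on the finite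
(multi)graph with edge-endpoint maps `g1, g2`. -/
def curDeg (g1 g2 : E → V) (n : E → ℕ) (x : V) : ℕ :=
  ∑ e : E, if x = g1 e ∨ x = g2 e then n e else 0

/-- The source set `∂n = {x ∈ V : ∑_{e ∋ x} n_e is odd}` of a current `n`. -/
def curSources (g1 g2 : E → V) (n : E → ℕ) : Finset V :=
  Finset.univ.filter fun x => Odd (curDeg g1 g2 n x)

/-- The random-current weight `w(n) = ∏_{e∈E} (βJ_e)^{n_e}/n_e!`. -/
def curWeight (β : ℝ) (J : E → ℝ) (n : E → ℕ) : ℝ :=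
  ∏ e : E, (β * J e) ^ n e / (Nat.factorial (n e) : ℝ)

/-- The random-current partition function `Z(F) = ∑_{n : ∂n = F} w(n)`. -/
def curZ (g1 g2 : E → V) (β : ℝ) (J : E → ℝ) (F : Finset V) : ℝ :=
  ∑' n : E → ℕ, if curSources g1 g2 n = F then curWeight β J n else 0

lemma curWeight_nonneg {E : Type} [Fintype E] {β : ℝ} {J : E → ℝ} (hJ : ∀ e, 0 ≤ β * J e)
    (n : E → ℕ) :
    0 ≤ curWeight β J n :=
  Finset.prod_nonneg fun e _ => div_nonneg (pow_nonneg (hJ e) _) (Nat.cast_nonneg _)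

lemma summable_curWeight {β : ℝ} {J : E → ℝ} (hJ : ∀ e, 0 ≤ β * J e) :
    Summable (curWeight β J) := by
  refine summable_of_sum_le (c := ∏ e, Real.exp (β * J e)) (curWeight_nonneg hJ) fun u => ?_
  let N := ∑ n ∈ u, ∑ e, n e
  have hu : u ⊆ Fintype.piFinset fun _ : E => Finset.range (N + 1) := by
    intro n hn
    refine Fintype.mem_piFinset.2 fun e => Finset.mem_range_succ_iff.2 ?_
    exact (Finset.single_le_sum (fun _ _ => Nat.zero_le _) (Finset.mem_univ e)).trans
      (Finset.single_le_sum (f := fun n : E → ℕ => ∑ e, n e) (fun _ _ => Nat.zero_le _) hn)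
  calc ∑ n ∈ u, curWeight β J n
      ≤ ∑ n ∈ Fintype.piFinset fun _ : E => Finset.range (N + 1), curWeight β J n :=
        Finset.sum_le_sum_of_subset_of_nonneg hu fun n _ _ => curWeight_nonneg hJ n
    _ = ∏ e, ∑ k ∈ Finset.range (N + 1), (β * J e) ^ k / (Nat.factorial k : ℝ) :=
        (Finset.prod_univ_sum (fun _ : E => Finset.range (N + 1))
          fun e k => (β * J e) ^ k / (Nat.factorial k : ℝ)).symm
    _ ≤ ∏ e, Real.exp (β * J e) :=
        Finset.prod_le_prod
          (fun e _ => Finset.sum_nonneg fun k _ =>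
            div_nonneg (pow_nonneg (hJ e) _) (Nat.cast_nonneg _))
          fun e _ => Real.sum_le_exp_of_nonneg (hJ e) _

lemma curWeight_update (β : ℝ) (J : E → ℝ) {n : E → ℕ} {f : E} (hn : n f = 0) (k : ℕ) :
    curWeight β J (Function.update n f k) =
      curWeight β J n * ((β * J f) ^ k / (Nat.factorial k : ℝ)) := by
  have hrest : ∏ e ∈ Finset.univ.erase f,
      (β * J e) ^ Function.update n f k e / (Nat.factorial (Function.update n f k e) : ℝ) =
      ∏ e ∈ Finset.univ.erase f, (β * J e) ^ n e / (Nat.factorial (n e) : ℝ) :=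
    Finset.prod_congr rfl fun e he => by
      rw [Function.update_of_ne (Finset.ne_of_mem_erase he)]
  rw [curWeight, curWeight, ← Finset.prod_erase_mul _ _ (Finset.mem_univ f), hrest,
    ← Finset.prod_erase_mul _ _ (Finset.mem_univ f)]
  simp [hn]

/-- Raising the current along an edge by an even amount does not change the sources. -/
lemma curSources_update_two_mul (g1 g2 : E → V) {n : E → ℕ} {f : E} (hn : n f = 0) (k : ℕ) :
    curSources g1 g2 (Function.update n f (2 * k)) = curSources g1 g2 n := by
  refine Finset.filter_congr fun x _ => ?_
  have hrest : ∑ e ∈ Finset.univ.erase f,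
      (if x = g1 e ∨ x = g2 e then Function.update n f (2 * k) e else 0) =
      ∑ e ∈ Finset.univ.erase f, if x = g1 e ∨ x = g2 e then n e else 0 :=
    Finset.sum_congr rfl fun e he => by
      rw [Function.update_of_ne (Finset.ne_of_mem_erase he)]
  rw [curDeg, curDeg, ← Finset.sum_erase_add _ _ (Finset.mem_univ f), hrest,
    ← Finset.sum_erase_add _ _ (Finset.mem_univ f)]
  split_ifs <;> simp [hn, Nat.odd_add]

/-- The currents with sources `F` and an even value at `f` contribute
`cosh (β J_f)` times the weight of those vanishing at `f`. -/
lemma tsum_curWeight_mul_cosh_le (g1 g2 : E → V) {β : ℝ} {J : E → ℝ}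
    (hJ : ∀ e, 0 ≤ β * J e) (F : Finset V) (f : E) :
    (∑' n : E → ℕ, if curSources g1 g2 n = F ∧ n f = 0 then curWeight β J n else 0) *
      Real.cosh (β * J f) ≤ curZ g1 g2 β J F := by
  let S : Set (E → ℕ) := {n | curSources g1 g2 n = F ∧ n f = 0}
  have hS : (∑' n : E → ℕ, if curSources g1 g2 n = F ∧ n f = 0 then curWeight β J n else 0) =
      ∑' n : S, curWeight β J n := by
    rw [tsum_subtype]
    simp [S, Set.indicator_apply]
  have hsum : Summable fun n : S => curWeight β J n := (summable_curWeight hJ).subtype S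
  have hcosh := Real.hasSum_cosh (β * J f)
  have hprod := hsum.mul_of_nonneg hcosh.summable (fun n => curWeight_nonneg hJ n.1)
    fun k => div_nonneg (pow_nonneg (hJ f) _) (Nat.cast_nonneg _)
  have hZ : Summable fun n : E → ℕ =>
      if curSources g1 g2 n = F then curWeight β J n else 0 := by
    refine ((summable_curWeight hJ).indicator {n | curSources g1 g2 n = F}).congr fun n => ?_
    simp [Set.indicator_apply]
  have hinj : Function.Injective
      fun p : S × ℕ => Function.update (p.1 : E → ℕ) f (2 * p.2) := by
    rintro ⟨⟨n, _, hn⟩, k⟩ ⟨⟨m, _, hm⟩, l⟩ h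
    have hkl : k = l := by simpa using congrFun h f
    have hnm : n = m := by
      funext e
      by_cases he : e = f
      · rw [he, hn, hm]
      · simpa [he] using congrFun h e
    subst hkl hnm
    rfl
  rw [hS, ← hcosh.tsum_eq, hsum.tsum_mul_tsum hcosh.summable hprod]
  refine hprod.tsum_le_tsum_of_inj _ hinj (fun n _ => ?_) (fun p => ?_) hZ
  · split_ifs
    exacts [curWeight_nonneg hJ n, le_rfl]
  · rw [curSources_update_two_mul g1 g2 p.1.2.2, if_pos p.1.2.1, curWeight_update β J p.1.2.2]

/-- for any `F ⊆ V` and any edge `f`,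
`∑_{∂n = F, n_f = 0} w(n) ≤ 2 e^{−βJ_f} Z(F)`. -/
theorem statement9 (g1 g2 : E → V) (hloop : ∀ e, g1 e ≠ g2 e)
    (J : E → ℝ) (hJ : ∀ e, 0 ≤ J e) (β : ℝ) (hβ : 0 < β)
    (F : Finset V) (f : E) :
    (∑' n : E → ℕ,
        if curSources g1 g2 n = F ∧ n f = 0 then curWeight β J n else 0)
      ≤ 2 * Real.exp (-(β * J f)) * curZ g1 g2 β J F := by
  have hx : ∀ e, 0 ≤ β * J e := fun e => mul_nonneg hβ.le (hJ e)
  have hle := tsum_curWeight_mul_cosh_le g1 g2 hx F f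
  set A := ∑' n : E → ℕ, if curSources g1 g2 n = F ∧ n f = 0 then curWeight β J n else 0
  have hA : 0 ≤ A := tsum_nonneg fun n => by
    split_ifs
    exacts [curWeight_nonneg hx n, le_rfl]
  have hone : 1 ≤ 2 * Real.exp (-(β * J f)) * Real.cosh (β * J f) := by
    have hmul : Real.exp (-(β * J f)) * Real.exp (β * J f) = 1 := by
      rw [← Real.exp_add, neg_add_cancel, Real.exp_zero]
    rw [Real.cosh_eq]
    nlinarith [sq_nonneg (Real.exp (-(β * J f)))]
  calc A ≤ A * (2 * Real.exp (-(β * J f)) * Real.cosh (β * J f)) :=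
        le_mul_of_one_le_right hA hone
    _ = 2 * Real.exp (-(β * J f)) * (A * Real.cosh (β * J f)) := by ring
    _ ≤ 2 * Real.exp (-(β * J f)) * curZ g1 g2 β J F := by gcongr
end
end
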